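/- arXiv:1903.08519 — 2 statements merged into one kernel-verified Lean document; each statement's English description precedes it below -/
import Mathlib

section
/- Let σ : ℝ → ℝ be the sigmoid function and let m ≥ 1 be a natural number. Then the function g(z) = m·σ(z)^m·(1 − σ(z)) is strictly increasing on the interval (−∞, log m] and strictly decreasing on the interval [log m, +∞); consequently z = log m is the unique global maximum of g. -/
noncomputable def sigmoid (z : ℝ) : ℝ := 1 / (1 + Real.exp (-z))

theorem sigmoid_eq_real_sigmoid : sigmoid = Real.sigmoid := by
  funext z
  rw [sigmoid, Real.sigmoid_def, one_div]

theorem one_sub_sigmoid (z : ℝ) : 1 - sigmoid z = sigmoid z * Real.exp (-z) := by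
  rw [sigmoid_eq_real_sigmoid, Real.sigmoid_mul_rexp_neg, Real.sigmoid_neg]

theorem sigmoid_pos (z : ℝ) : 0 < sigmoid z := by
  rw [sigmoid_eq_real_sigmoid]
  exact Real.sigmoid_pos z

theorem hasDerivAt_sigmoid (z : ℝ) :
    HasDerivAt sigmoid (sigmoid z * (1 - sigmoid z)) z := by
  rw [sigmoid_eq_real_sigmoid]
  exact Real.hasDerivAt_sigmoid z

theorem hasDerivAt_sigmoid_pow_mul_one_sub (m : ℕ) (hm : 1 ≤ m) (z : ℝ) :
    HasDerivAt (fun z : ℝ => (m : ℝ) * sigmoid z ^ m * (1 - sigmoid z))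
      (m * sigmoid z ^ (m + 2) * Real.exp (-z) * (m * Real.exp (-z) - 1)) z := by
  have h := hasDerivAt_sigmoid z
  refine (((h.pow m).const_mul (m : ℝ)).mul (h.const_sub 1)).congr_deriv ?_
  obtain ⟨k, rfl⟩ := Nat.exists_eq_add_of_le' hm
  simp only [Pi.pow_apply, one_sub_sigmoid, Nat.add_sub_cancel]
  ring

theorem sigmoid_pow_deriv_monotonicity_and_max (m : ℕ) (hm : 1 ≤ m) :
    StrictMonoOn (fun z : ℝ => (m : ℝ) * sigmoid z ^ m * (1 - sigmoid z))
      (Set.Iic (Real.log m)) ∧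
    StrictAntiOn (fun z : ℝ => (m : ℝ) * sigmoid z ^ m * (1 - sigmoid z))
      (Set.Ici (Real.log m)) ∧
    ∀ z : ℝ, z ≠ Real.log m →
      (m : ℝ) * sigmoid z ^ m * (1 - sigmoid z) <
        (m : ℝ) * sigmoid (Real.log m) ^ m * (1 - sigmoid (Real.log m)) := by
  have hm0 : (0 : ℝ) < m := by exact_mod_cast hm
  have hderiv := hasDerivAt_sigmoid_pow_mul_one_sub m hm
  have hcont : Continuous (fun z : ℝ => (m : ℝ) * sigmoid z ^ m * (1 - sigmoid z)) :=
    continuous_iff_continuousAt.2 fun z => (hderiv z).continuousAt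
  have hfactor (z : ℝ) : 0 < m * sigmoid z ^ (m + 2) * Real.exp (-z) := by
    have := sigmoid_pos z
    positivity
  have hexp (z : ℝ) : (m : ℝ) * Real.exp (-z) = Real.exp (Real.log m - z) := by
    rw [sub_eq_add_neg, Real.exp_add, Real.exp_log hm0]
  have hmono : StrictMonoOn (fun z : ℝ => (m : ℝ) * sigmoid z ^ m * (1 - sigmoid z))
      (Set.Iic (Real.log m)) := by
    refine strictMonoOn_of_deriv_pos (convex_Iic _) hcont.continuousOn fun z hz => ?_
    rw [interior_Iic, Set.mem_Iio] at hz
    rw [(hderiv z).deriv]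
    refine mul_pos (hfactor z) (sub_pos.2 ?_)
    rw [hexp]
    exact Real.one_lt_exp_iff.2 (sub_pos.2 hz)
  have hanti : StrictAntiOn (fun z : ℝ => (m : ℝ) * sigmoid z ^ m * (1 - sigmoid z))
      (Set.Ici (Real.log m)) := by
    refine strictAntiOn_of_deriv_neg (convex_Ici _) hcont.continuousOn fun z hz => ?_
    rw [interior_Ici, Set.mem_Ioi] at hz
    rw [(hderiv z).deriv]
    refine mul_neg_of_pos_of_neg (hfactor z) (sub_neg.2 ?_)
    rw [hexp]
    exact Real.exp_lt_one_iff.2 (sub_neg.2 hz)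
  refine ⟨hmono, hanti, fun z hz => ?_⟩
  rcases lt_or_gt_of_ne hz with h | h
  · exact hmono h.le Set.self_mem_Iic h
  · exact hanti Set.self_mem_Ici h.le h
end

section
/- Let σ : ℝ → ℝ be the sigmoid function, let m ≥ 1 be a natural number, and let a, b ∈ ℝ. Then |σ(b)^m − σ(a)^m| ≤ ρ_m(a,b)·|b − a|. -/
noncomputable def rho (m : ℕ) (a b : ℝ) : ℝ :=
  if Real.log m < min a b then
    (m : ℝ) * sigmoid (min a b) ^ m * (1 - sigmoid (min a b))
  else if max a b < Real.log m then
    (m : ℝ) * sigmoid (max a b) ^ m * (1 - sigmoid (max a b))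
  else ((m : ℝ) / (m + 1)) ^ (m + 1)

theorem sigmoid_monotone : Monotone sigmoid :=
  sigmoid_eq_real_sigmoid ▸ Real.sigmoid_monotone

theorem one_sub_sigmoid_pos (z : ℝ) : 0 < 1 - sigmoid z :=
  sub_pos.2 (sigmoid_eq_real_sigmoid ▸ Real.sigmoid_lt_one z)

theorem sigmoid_log {x : ℝ} (hx : 0 < x) : sigmoid (Real.log x) = x / (x + 1) := by
  rw [sigmoid, Real.exp_neg, Real.exp_log hx]
  field_simp

/-- The derivative of `sigmoid ^ m`. -/
noncomputable def sigmoidPowDeriv (m : ℕ) (z : ℝ) : ℝ :=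
  (m : ℝ) * sigmoid z ^ m * (1 - sigmoid z)

theorem sigmoidPowDeriv_nonneg (m : ℕ) (z : ℝ) : 0 ≤ sigmoidPowDeriv m z := by
  have := sigmoid_pos z
  have := one_sub_sigmoid_pos z
  unfold sigmoidPowDeriv
  positivity

theorem hasDerivAt_sigmoid_pow {m : ℕ} (hm : 1 ≤ m) (z : ℝ) :
    HasDerivAt (fun t => sigmoid t ^ m) (sigmoidPowDeriv m z) z := by
  refine ((hasDerivAt_sigmoid z).fun_pow m).congr_deriv ?_
  obtain ⟨k, rfl⟩ := Nat.exists_eq_add_of_le' hm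
  simp only [sigmoidPowDeriv, Nat.add_sub_cancel]
  ring

theorem hasDerivAt_sigmoidPowDeriv {m : ℕ} (hm : 1 ≤ m) (z : ℝ) :
    HasDerivAt (sigmoidPowDeriv m)
      (sigmoidPowDeriv m z * (m - (m + 1) * sigmoid z)) z := by
  have h := ((hasDerivAt_sigmoid_pow hm z).const_mul (m : ℝ)).mul
    ((hasDerivAt_sigmoid z).const_sub 1)
  refine h.congr_deriv ?_
  simp only [sigmoidPowDeriv]
  ring

theorem monotoneOn_sigmoidPowDeriv {m : ℕ} (hm : 1 ≤ m) :
    MonotoneOn (sigmoidPowDeriv m) (Set.Iic (Real.log m)) := by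
  have hd := hasDerivAt_sigmoidPowDeriv hm
  refine monotoneOn_of_deriv_nonneg (convex_Iic _)
    (fun z _ => (hd z).continuousAt.continuousWithinAt)
    (fun z _ => (hd z).differentiableAt.differentiableWithinAt) fun z hz => ?_
  rw [(hd z).deriv]
  refine mul_nonneg (sigmoidPowDeriv_nonneg m z) ?_
  have h := sigmoid_monotone (Set.mem_Iic.1 (interior_subset hz))
  rw [sigmoid_log (by positivity), le_div_iff₀ (by positivity)] at h
  linarith

theorem antitoneOn_sigmoidPowDeriv {m : ℕ} (hm : 1 ≤ m) :
    AntitoneOn (sigmoidPowDeriv m) (Set.Ici (Real.log m)) := by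
  have hd := hasDerivAt_sigmoidPowDeriv hm
  refine antitoneOn_of_deriv_nonpos (convex_Ici _)
    (fun z _ => (hd z).continuousAt.continuousWithinAt)
    (fun z _ => (hd z).differentiableAt.differentiableWithinAt) fun z hz => ?_
  rw [(hd z).deriv]
  refine mul_nonpos_of_nonneg_of_nonpos (sigmoidPowDeriv_nonneg m z) ?_
  have h := sigmoid_monotone (Set.mem_Ici.1 (interior_subset hz))
  rw [sigmoid_log (by positivity), div_le_iff₀ (by positivity)] at h
  linarith

theorem sigmoidPowDeriv_log {m : ℕ} (hm : 1 ≤ m) :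
    sigmoidPowDeriv m (Real.log m) = ((m : ℝ) / (m + 1)) ^ (m + 1) := by
  rw [sigmoidPowDeriv, sigmoid_log (by positivity), pow_succ]
  field_simp
  ring

theorem sigmoidPowDeriv_le_rho {m : ℕ} (hm : 1 ≤ m) {a b z : ℝ} (hz : z ∈ Set.uIcc a b) :
    sigmoidPowDeriv m z ≤ rho m a b := by
  obtain ⟨h₁, h₂⟩ : min a b ≤ z ∧ z ≤ max a b := hz
  unfold rho
  split_ifs with ha hb
  · exact antitoneOn_sigmoidPowDeriv hm ha.le (ha.le.trans h₁) h₁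
  · exact monotoneOn_sigmoidPowDeriv hm (h₂.trans hb.le) hb.le h₂
  · rw [← sigmoidPowDeriv_log hm]
    rcases le_total z (Real.log m) with h | h
    · exact monotoneOn_sigmoidPowDeriv hm h Set.self_mem_Iic h
    · exact antitoneOn_sigmoidPowDeriv hm Set.self_mem_Ici h h

theorem sigmoid_pow_lipschitz_rho (m : ℕ) (hm : 1 ≤ m) (a b : ℝ) :
    |sigmoid b ^ m - sigmoid a ^ m| ≤ rho m a b * |b - a| := by
  refine (convex_uIcc a b).norm_image_sub_le_of_norm_hasDerivWithin_le
    (fun z _ => (hasDerivAt_sigmoid_pow hm z).hasDerivWithinAt) (fun z hz => ?_)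
    Set.left_mem_uIcc Set.right_mem_uIcc
  rw [Real.norm_of_nonneg (sigmoidPowDeriv_nonneg m z)]
  exact sigmoidPowDeriv_le_rho hm hz
end
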